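/- For the KKM potential V_I, the square of the Poisson bracket C₁ = {A₁,B₁} satisfies C₁² = 2F₁, where F₁ is the cubic polynomial in the integrals given by F₁ = −8(A₁²(α₂+B₁) + A₁B₁(A₂−H) + δB₁² + α₁((A₁+A₂−H)² − 4α₂δ)). -/

import Mathlib

noncomputable section

open MvPolynomial

/-- The field of rational functions over ℝ in the six variables
`x, y, z, p_x, p_y, p_z`: the fraction field of the polynomial ring. -/
abbrev K6 : Type := FractionRing (MvPolynomial (Fin 6) ℝ)

/-- The canonical embedding of the polynomial ring into its fraction field. -/
def toK6 : MvPolynomial (Fin 6) ℝ →+* K6 :=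
  algebraMap (MvPolynomial (Fin 6) ℝ) K6

/-- Constants, embedded in `K6`. -/
def cR (a : ℝ) : K6 := toK6 (MvPolynomial.C a)

def vx : K6 := toK6 (MvPolynomial.X 0)
def vy : K6 := toK6 (MvPolynomial.X 1)
def vz : K6 := toK6 (MvPolynomial.X 2)
def vpx : K6 := toK6 (MvPolynomial.X 3)
def vpy : K6 := toK6 (MvPolynomial.X 4)
def vpz : K6 := toK6 (MvPolynomial.X 5)

/-- `D` is the (unique) extension to the fraction field of the formal partial
derivative `pderiv j` on the polynomial ring: an additive map satisfying the
Leibniz rule which agrees with `pderiv j` on polynomials. -/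
def IsPDeriv (j : Fin 6) (D : K6 → K6) : Prop :=
  (∀ f g : K6, D (f + g) = D f + D g) ∧
  (∀ f g : K6, D (f * g) = D f * g + f * D g) ∧
  (∀ p, D (toK6 p) = toK6 (pderiv j p))

/-- The canonical Poisson bracket on `K6`, where `Pd 0, …, Pd 5` are the
partial derivatives with respect to `x, y, z, p_x, p_y, p_z` respectively:
`{f,g} = f_x g_{p_x} + f_y g_{p_y} + f_z g_{p_z}
  - f_{p_x} g_x - f_{p_y} g_y - f_{p_z} g_z`. -/
def poisson (Pd : Fin 6 → K6 → K6) (f g : K6) : K6 :=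
  Pd 0 f * Pd 3 g + Pd 1 f * Pd 4 g + Pd 2 f * Pd 5 g
    - Pd 3 f * Pd 0 g - Pd 4 f * Pd 1 g - Pd 5 f * Pd 2 g

/-- Angular momentum `J_x = y p_z - z p_y`. -/
def Jx : K6 := vy * vpz - vz * vpy
/-- Angular momentum `J_y = z p_x - x p_z`. -/
def Jy : K6 := vz * vpx - vx * vpz
/-- Angular momentum `J_z = x p_y - y p_x`. -/
def Jz : K6 := vx * vpy - vy * vpx
/-- Total angular momentum squared `J² = J_x² + J_y² + J_z²`. -/
def Jsq : K6 := Jx ^ 2 + Jy ^ 2 + Jz ^ 2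

/-- KKM V_I Hamiltonian. -/
def HV (α₁ α₂ α₃ δ : ℝ) : K6 :=
  vpx ^ 2 + vpy ^ 2 + vpz ^ 2 + cR δ * (vx ^ 2 + vy ^ 2 + vz ^ 2)
    + cR α₁ / vx ^ 2 + cR α₂ / vy ^ 2 + cR α₃ / vz ^ 2

def A1V (α₁ δ : ℝ) : K6 := vpx ^ 2 + cR δ * vx ^ 2 + cR α₁ / vx ^ 2

def A2V (α₃ δ : ℝ) : K6 := vpz ^ 2 + cR δ * vz ^ 2 + cR α₃ / vz ^ 2

def B1V (α₁ α₂ : ℝ) : K6 :=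
  Jz ^ 2 + cR α₂ * vx ^ 2 / vy ^ 2 + cR α₁ * vy ^ 2 / vx ^ 2

def B2V (α₂ α₃ : ℝ) : K6 :=
  Jx ^ 2 + cR α₃ * vy ^ 2 / vz ^ 2 + cR α₂ * vz ^ 2 / vy ^ 2

def FV (α₁ α₂ α₃ : ℝ) : K6 :=
  Jsq + cR α₂ * (vx ^ 2 + vz ^ 2) / vy ^ 2
    + (cR α₃ * vx ^ 2 * (vx ^ 2 + vy ^ 2) + cR α₁ * vz ^ 2 * (vy ^ 2 + vz ^ 2))
      / (vx ^ 2 * vz ^ 2)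

theorem toK6_X_ne_zero (i : Fin 6) : toK6 (X i) ≠ 0 :=
  (map_ne_zero_iff toK6 (IsFractionRing.injective _ _)).2 (X_ne_zero i)

namespace IsPDeriv

theorem map_sq {j : Fin 6} {D : K6 → K6} (hD : IsPDeriv j D) (f : K6) :
    D (f ^ 2) = 2 * f * D f := by
  rw [sq, hD.2.1]
  ring

theorem map_sub {j : Fin 6} {D : K6 → K6} (hD : IsPDeriv j D) (f g : K6) :
    D (f - g) = D f - D g := by
  rw [eq_sub_iff_add_eq, ← hD.1, sub_add_cancel]

theorem map_div_sq {j : Fin 6} {D : K6 → K6} (hD : IsPDeriv j D) (f : K6) {g : K6}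
    (hg : g ≠ 0) : D (f / g ^ 2) = D f / g ^ 2 - 2 * f * D g / g ^ 3 := by
  have h : D f = D (f / g ^ 2) * g ^ 2 + f / g ^ 2 * (2 * g * D g) := by
    rw [← hD.map_sq, ← hD.2.1, div_mul_cancel₀ f (pow_ne_zero 2 hg)]
  rw [h]
  field_simp
  ring

theorem map_cR {j : Fin 6} {D : K6 → K6} (hD : IsPDeriv j D) (a : ℝ) : D (cR a) = 0 := by
  rw [cR, hD.2.2, pderiv_C, map_zero]

theorem map_X {j : Fin 6} {D : K6 → K6} (hD : IsPDeriv j D) (i : Fin 6) :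
    D (toK6 (X i)) = if i = j then 1 else 0 := by
  rw [hD.2.2, pderiv_X, Pi.single_apply]
  split_ifs <;> simp_all

/-- The derivative of `A1V` is determined by the derivatives of `x` and `p_x`. -/
theorem map_A1V {j : Fin 6} {D : K6 → K6} (hD : IsPDeriv j D) (α₁ δ : ℝ) :
    D (A1V α₁ δ) =
      2 * vpx * D vpx + (2 * cR δ * vx - 2 * cR α₁ / vx ^ 3) * D vx := by
  have hx : vx ≠ 0 := toK6_X_ne_zero 0
  rw [A1V, hD.1, hD.1, hD.2.1, hD.map_div_sq _ hx, hD.map_sq, hD.map_sq, hD.map_cR, hD.map_cR]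
  ring

/-- The derivative of `B1V` is determined by those of `x`, `y`, `p_x` and `p_y`. -/
theorem map_B1V {j : Fin 6} {D : K6 → K6} (hD : IsPDeriv j D) (α₁ α₂ : ℝ) :
    D (B1V α₁ α₂) =
      2 * Jz * (D vx * vpy + vx * D vpy - D vy * vpx - vy * D vpx)
        + (2 * cR α₂ * vx / vy ^ 2 - 2 * cR α₁ * vy ^ 2 / vx ^ 3) * D vx
        + (2 * cR α₁ * vy / vx ^ 2 - 2 * cR α₂ * vx ^ 2 / vy ^ 3) * D vy := by
  have hx : vx ≠ 0 := toK6_X_ne_zero 0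
  have hy : vy ≠ 0 := toK6_X_ne_zero 1
  rw [B1V, hD.1, hD.1, hD.map_div_sq _ hx, hD.map_div_sq _ hy, hD.map_sq, hD.2.1 (cR α₁),
    hD.2.1 (cR α₂), hD.map_sq, hD.map_sq, hD.map_cR, hD.map_cR, Jz, hD.map_sub, hD.2.1, hD.2.1]
  ring

end IsPDeriv

/-- The bracket `C₁ = {A₁, B₁}` in closed form. -/
theorem poisson_A1V_B1V (α₁ α₂ δ : ℝ) {Pd : Fin 6 → K6 → K6} (hPd : ∀ j, IsPDeriv j (Pd j)) :
    poisson Pd (A1V α₁ δ) (B1V α₁ α₂) =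
      -(2 * cR δ * vx - 2 * cR α₁ / vx ^ 3) * (2 * vy * Jz)
        - 2 * vpx * (2 * vpy * Jz + 2 * cR α₂ * vx / vy ^ 2 - 2 * cR α₁ * vy ^ 2 / vx ^ 3) := by
  have hX : ∀ j, Pd j vx = if 0 = j then 1 else 0 := fun j => (hPd j).map_X 0
  have hY : ∀ j, Pd j vy = if 1 = j then 1 else 0 := fun j => (hPd j).map_X 1
  have hPX : ∀ j, Pd j vpx = if 3 = j then 1 else 0 := fun j => (hPd j).map_X 3
  have hPY : ∀ j, Pd j vpy = if 4 = j then 1 else 0 := fun j => (hPd j).map_X 4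
  simp only [poisson, (hPd _).map_A1V, (hPd _).map_B1V, hX, hY, hPX, hPY, Fin.reduceEq, if_true,
    if_false]
  ring

theorem kkm_VI_C1_sq (α₁ α₂ α₃ δ : ℝ) (Pd : Fin 6 → K6 → K6)
    (hPd : ∀ j, IsPDeriv j (Pd j))
    (H A1 A2 B1 B2 F : K6)
    (hH : H = HV α₁ α₂ α₃ δ) (hA1 : A1 = A1V α₁ δ) (hA2 : A2 = A2V α₃ δ)
    (hB1 : B1 = B1V α₁ α₂) (hB2 : B2 = B2V α₂ α₃) (hF : F = FV α₁ α₂ α₃) :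
    (poisson Pd A1 B1) ^ 2 =
      2 * (-8 * (A1 ^ 2 * (cR α₂ + B1) + A1 * B1 * (A2 - H) + cR δ * B1 ^ 2
        + cR α₁ * ((A1 + A2 - H) ^ 2 - 4 * cR α₂ * cR δ))) := by
  have hx : vx ≠ 0 := toK6_X_ne_zero 0
  have hy : vy ≠ 0 := toK6_X_ne_zero 1
  subst hH hA1 hA2 hB1
  rw [poisson_A1V_B1V α₁ α₂ δ hPd]
  have hAH : A2V α₃ δ - HV α₁ α₂ α₃ δ =
      -A1V α₁ δ - (vpy ^ 2 + cR δ * vy ^ 2 + cR α₂ / vy ^ 2) := by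
    simp only [A1V, A2V, HV]
    ring
  rw [add_sub_assoc (A1V α₁ δ), hAH]
  simp only [A1V, B1V, Jz]
  generalize vx = x at *
  generalize vy = y at *
  field_simp
  ring
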